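/- (Happel–Ringel) Let k be an algebraically closed field and let 𝒜 be a Hom-finite hereditary abelian k-linear category. If I is an indecomposable object of 𝒜 with Ext¹(I, I) = 0, then End(I) = k (i.e. every endomorphism of I is a scalar multiple of the identity). -/

import Mathlib

open CategoryTheory Abelian

universe w v u

section Helpers

open Limits

variable {C : Type u} [Category.{v} C] [Abelian C]

lemma hr_split_mono {I M : C} (hind : Indecomposable I) (i : M ⟶ I) (r : I ⟶ M)
    (h : i ≫ r = 𝟙 M) : IsZero M ∨ IsIso i := by
  have : IsSplitMono i := IsSplitMono.mk' ⟨r, h⟩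
  have hb := isBilimitBinaryBiconeOfIsSplitMonoOfCokernel (cokernelIsCokernel i)
  rcases hind.2 M (cokernel i) (biprod.uniqueUpToIso _ _ hb) with h1 | h1
  · exact Or.inl h1
  · right
    have : Epi i := Preadditive.epi_of_isZero_cokernel i h1
    exact isIso_of_mono_of_epi i

lemma hr_idem {I : C} (hind : Indecomposable I) (g : I ⟶ I) (hg : g ≫ g = g) :
    g = 0 ∨ g = 𝟙 I := by
  obtain ⟨Y, i, e, h1, h2⟩ := IsIdempotentComplete.idempotents_split I g hg
  rcases hr_split_mono hind i e h1 with h | h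
  · left
    rw [← h2, h.eq_of_src i 0, comp_zero]
  · right
    rw [← h2, ← cancel_epi i, ← Category.assoc, h1, Category.id_comp, Category.comp_id]

lemma hr_fitting (k : Type*) [Field k] [Linear k C]
    {I : C} (hfin : FiniteDimensional k (I ⟶ I)) (hind : Indecomposable I) (f : End I) :
    IsUnit f ∨ IsNilpotent f := by
  have : FiniteDimensional k (End I) := hfin
  let A := Algebra.adjoin k {f}
  let : CommRing A := Algebra.adjoinCommRingOfComm k (by
    rintro a ha b hb
    rw [Set.mem_singleton_iff.1 ha, Set.mem_singleton_iff.1 hb])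
  have : FiniteDimensional k A := FiniteDimensional.finiteDimensional_subalgebra A
  have : IsArtinianRing A := IsArtinianRing.of_finite k A
  let x : A := ⟨f, Algebra.self_mem_adjoin_singleton k f⟩
  obtain ⟨n, y, hy⟩ := IsArtinian.exists_pow_succ_smul_dvd x (1 : A)
  simp only [smul_eq_mul, mul_one] at hy
  -- x^(n+1) * y = x^n
  have h0 : ∀ m, x ^ (n + m) * y ^ m = x ^ n := by
    intro m
    induction m with
    | zero => simp
    | succ m ih =>
      calc x ^ (n + (m + 1)) * y ^ (m + 1) = x ^ m * (x ^ (n + 1) * y) * y ^ m := by ring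
        _ = x ^ (n + m) * y ^ m := by rw [hy]; ring
        _ = _ := ih
  have hN : x ^ (n + 1) * (x ^ (n + 1) * y ^ (n + 1)) = x ^ (n + 1) := by
    calc _ = x * (x ^ (n + (n + 1)) * y ^ (n + 1)) := by ring
      _ = _ := by rw [h0]; ring
  have hidem : (x ^ (n + 1) * y ^ (n + 1)) * (x ^ (n + 1) * y ^ (n + 1))
      = x ^ (n + 1) * y ^ (n + 1) := by
    calc _ = (x ^ (n + 1) * (x ^ (n + 1) * y ^ (n + 1))) * y ^ (n + 1) := by ring
      _ = _ := by rw [hN]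
  have key := hr_idem hind ((x ^ (n + 1) * y ^ (n + 1) : A) : End I) (congrArg Subtype.val hidem)
  rcases key with h | h
  · right
    have h' : (x ^ (n + 1) * y ^ (n + 1) : A) = 0 := Subtype.ext h
    refine ⟨n + 1, ?_⟩
    rw [h', mul_zero] at hN
    exact (congrArg Subtype.val hN).symm
  · left
    have h' : (x ^ (n + 1) * y ^ (n + 1) : A) = 1 := Subtype.ext h
    have hu : IsUnit x := IsUnit.of_mul_eq_one (x ^ n * y ^ (n + 1)) (by rw [← h']; ring)
    exact hu.map A.val

lemma hr_mono_nil {I : C} (f : End I) (hn : IsNilpotent f) [h : Mono (f : I ⟶ I)] : IsZero I := by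
  obtain ⟨n, hn⟩ := hn
  have : ∀ m, f ^ m = 0 → IsZero I := by
    intro m
    induction m with
    | zero => intro h0; exact (IsZero.iff_id_eq_zero I).2 h0
    | succ m ih =>
      intro h0
      apply ih
      rw [pow_succ'] at h0
      exact Limits.zero_of_comp_mono (f : I ⟶ I) h0
  exact this n hn

lemma hr_epi_nil {I : C} (f : End I) (hn : IsNilpotent f) [h : Epi (f : I ⟶ I)] : IsZero I := by
  obtain ⟨n, hn⟩ := hn
  have : ∀ m, f ^ m = 0 → IsZero I := by
    intro m
    induction m with
    | zero => intro h0; exact (IsZero.iff_id_eq_zero I).2 h0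
    | succ m ih =>
      intro h0
      apply ih
      rw [pow_succ] at h0
      exact Limits.zero_of_epi_comp (f : I ⟶ I) h0
  exact this n hn

lemma hr_main (k : Type*) [Field k] [Linear k C] [HasExt.{w} C]
    (hered : ∀ X Y : C, Subsingleton (Ext.{w} X Y 2))
    (I : C) (hfin : FiniteDimensional k (I ⟶ I))
    (hind : Indecomposable I) (hrigid : Subsingleton (Ext.{w} I I 1))
    (M : C) (p : I ⟶ M) (i : M ⟶ I) [Epi p] [Mono i] :
    Mono p ∨ IsZero M ∨ IsIso i := by
  let S := ShortComplex.mk i (cokernel.π i) (cokernel.condition i)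
  let T := ShortComplex.mk (kernel.ι p) p (kernel.condition p)
  have hS : S.ShortExact :=
    { exact := ShortComplex.exact_cokernel i
      mono_f := inferInstanceAs (Mono i)
      epi_g := inferInstanceAs (Epi (cokernel.π i)) }
  have hT : T.ShortExact :=
    { exact := ShortComplex.exact_kernel p
      mono_f := inferInstanceAs (Mono (kernel.ι p))
      epi_g := inferInstanceAs (Epi p) }
  obtain ⟨ξ, hξ⟩ : ∃ ξ : Ext S.X₃ I 1, ξ.comp (Ext.mk₀ p) (add_zero 1) = hS.extClass :=
    Ext.covariant_sequence_exact₃ S.X₃ hT hS.extClass (n₁ := 2) rfl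
      ((hered _ _).elim _ _)
  obtain ⟨s', hs'⟩ := Ext.contravariant_sequence_exact₃ hS I ξ (hrigid.elim _ _) (add_zero 1)
  obtain ⟨s, rfl⟩ := Ext.mk₀_bijective _ _ |>.2 s'
  have hstep : ξ.comp (Ext.mk₀ (p ≫ s)) (add_zero 1) = ξ := by
    conv_rhs => rw [← hs', ← hξ]
    rw [← Ext.mk₀_comp_mk₀, Ext.comp_assoc_of_third_deg_zero]
  let e : End I := p ≫ s
  rcases hr_fitting k hfin hind e with h | h
  · left
    have : IsIso (p ≫ s) := (isUnit_iff_isIso _).1 h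
    exact mono_of_mono p s
  · right
    obtain ⟨n, hn⟩ := h
    have hpow : ∀ m, ξ.comp (Ext.mk₀ (e ^ m : End I)) (add_zero 1) = ξ := by
      intro m
      induction m with
      | zero => exact Ext.comp_mk₀_id ξ
      | succ m ih =>
        rw [pow_succ', End.mul_def, ← Ext.mk₀_comp_mk₀]
        rw [← Ext.comp_assoc_of_third_deg_zero, ih, hstep]
    have hξ0 : ξ = 0 := by
      rw [← hpow n, hn]
      have : Ext.mk₀ (0 : I ⟶ I) = 0 := Ext.mk₀_zero I I
      exact (congrArg (fun z => ξ.comp z (add_zero 1)) this).trans (Ext.comp_zero _ _ _ _ _)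
    have hη : hS.extClass = 0 := by rw [← hξ, hξ0, Ext.zero_comp]
    obtain ⟨r', hr'⟩ := Ext.contravariant_sequence_exact₁ hS M (Ext.mk₀ (𝟙 M)) (add_zero 1)
      (by rw [hη, Ext.zero_comp])
    obtain ⟨r, rfl⟩ := Ext.mk₀_bijective _ _ |>.2 r'
    rw [Ext.mk₀_comp_mk₀] at hr'
    exact hr_split_mono hind i r ((Ext.mk₀_bijective _ _).1 hr')

end Helpers

/-- (Happel–Ringel) In a Hom-finite hereditary abelian category over an algebraically
closed field `k`, an indecomposable object `I` with `Ext¹(I, I) = 0` has `End(I) = k`: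
every endomorphism of `I` is a scalar multiple of the identity. -/
theorem happel_ringel_brick
    (k : Type*) [Field k] [IsAlgClosed k]
    {C : Type u} [Category.{v} C] [Abelian C] [Linear k C] [HasExt.{w} C]
    (homFinite : ∀ X Y : C, FiniteDimensional k (X ⟶ Y))
    (hered : ∀ X Y : C, Subsingleton (Ext.{w} X Y 2))
    (I : C) (hind : Indecomposable I) (hrigid : Subsingleton (Ext.{w} I I 1)) :
    ∀ f : I ⟶ I, ∃ a : k, f = a • 𝟙 I := by
  intro f
  let f' : End I := f
  have hfd : FiniteDimensional k (End I) := homFinite I I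
  have : Nontrivial (End I) :=
    ⟨⟨1, 0, fun h => hind.1 ((Limits.IsZero.iff_id_eq_zero I).2 h)⟩⟩
  obtain ⟨a, ha⟩ := spectrum.nonempty_of_isAlgClosed_of_finiteDimensional k (A := End I) f'
  refine ⟨a, ?_⟩
  rw [spectrum.mem_iff] at ha
  let g : I ⟶ I := (algebraMap k (End I) a - f' : End I)
  have hnil : IsNilpotent (R := End I) g :=
    (hr_fitting k (homFinite I I) hind g).resolve_left ha
  have hg : a • 𝟙 I - f = g := by
    change _ = (algebraMap k (End I) a - f' : End I)
    rw [Algebra.algebraMap_eq_smul_one]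
    rfl
  have hfac : Abelian.factorThruImage g ≫ Abelian.image.ι g = g := Abelian.image.fac g
  rcases hr_main k hered I (homFinite I I) hind hrigid _ (Abelian.factorThruImage g)
    (Abelian.image.ι g) with h | h | h
  · have : Mono g := by rw [← hfac]; exact mono_comp _ _
    exact absurd (hr_mono_nil g hnil) hind.1
  · have : g = 0 := by
      rw [← hfac, h.eq_of_src (Abelian.image.ι g) 0, Limits.comp_zero]
    rw [this] at hg
    exact (sub_eq_zero.1 hg).symm
  · have : Epi g := by rw [← hfac]; exact epi_comp _ _
    exact absurd (hr_epi_nil g hnil) hind.1
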